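/- Let k be a field, let R1 and R2 be nonzero commutative noetherian k-algebras, let C1 be a semidualizing R1-module and C2 a semidualizing R2-module (so that C1 ⊗_k C2 is a semidualizing (R1 ⊗_k R2)-module), and let N1 be an R1-module and N2 an R2-module. If N1 belongs to the Bass class B_{C1}(R1) and N2 belongs to the Bass class B_{C2}(R2), then N1 ⊗_k N2 belongs to the Bass class B_{C1 ⊗_k C2}(R1 ⊗_k R2). Conversely, if N1 ≠ 0 and N2 ≠ 0 and N1 ⊗_k N2 belongs to B_{C1 ⊗_k C2}(R1 ⊗_k R2), then N1 ∈ B_{C1}(R1) and N2 ∈ B_{C2}(R2). -/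

import Mathlib

open TensorProduct CategoryTheory

section TensorModule

variable (k : Type) [CommRing k] (R1 R2 : Type) [CommRing R1] [CommRing R2]
  [Algebra k R1] [Algebra k R2]
variable (M1 M2 : Type) [AddCommGroup M1] [Module k M1] [Module R1 M1] [IsScalarTower k R1 M1]
  [AddCommGroup M2] [Module k M2] [Module R2 M2] [IsScalarTower k R2 M2]

/-- The action of `R2` on `M1 ⊗[k] M2` through the right factor, as an algebra morphism
to endomorphisms. -/
noncomputable def rightSMul : R2 →ₐ[k] Module.End k (M1 ⊗[k] M2) :=
  ((Module.endTensorEndAlgHom (R := k) (S := k) (A := k) (M := M1) (N := M2)).comp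
      (Algebra.TensorProduct.includeRight (R := k) (A := Module.End k M1))).comp
    (Algebra.lsmul k k M2 (A := R2))

/-- The `R2`-module structure on `M1 ⊗[k] M2` via the right factor. -/
noncomputable def rightModule : Module R2 (M1 ⊗[k] M2) :=
  Module.compHom _ (rightSMul k R2 M1 M2).toRingHom

/-- The `R1 ⊗[k] R2`-module structure on `M1 ⊗[k] M2`, characterized by
`(r1 ⊗ r2) • (m1 ⊗ m2) = (r1 • m1) ⊗ (r2 • m2)`; see `tensorModule_smul_tmul`. -/
noncomputable instance (priority := 10) tensorModule :
    Module (R1 ⊗[k] R2) (M1 ⊗[k] M2) :=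
  letI m2 : Module R2 (M1 ⊗[k] M2) := rightModule k R2 M1 M2
  haveI t2 : IsScalarTower k R2 (M1 ⊗[k] M2) := by
    refine IsScalarTower.of_algebraMap_smul (fun r x => ?_)
    show (rightSMul k R2 M1 M2) (algebraMap k R2 r) x = r • x
    rw [AlgHom.commutes]
    simp [Module.algebraMap_end_apply]
  haveI sc : SMulCommClass R1 R2 (M1 ⊗[k] M2) := by
    constructor
    intro r1 r2 x
    show r1 • (rightSMul k R2 M1 M2 r2) x = (rightSMul k R2 M1 M2 r2) (r1 • x)
    induction x using TensorProduct.induction_on with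
    | zero => simp
    | tmul m n =>
        have h1 : (rightSMul k R2 M1 M2 r2) (m ⊗ₜ[k] n) = m ⊗ₜ[k] (r2 • n) := rfl
        have h2 : (rightSMul k R2 M1 M2 r2) ((r1 • m) ⊗ₜ[k] n) = (r1 • m) ⊗ₜ[k] (r2 • n) := rfl
        rw [h1, smul_tmul', smul_tmul', h2]
    | add x y hx hy =>
        calc r1 • (rightSMul k R2 M1 M2 r2) (x + y)
            = r1 • ((rightSMul k R2 M1 M2 r2) x + (rightSMul k R2 M1 M2 r2) y) := by
              rw [(rightSMul k R2 M1 M2 r2).map_add]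
          _ = r1 • (rightSMul k R2 M1 M2 r2) x + r1 • (rightSMul k R2 M1 M2 r2) y :=
              smul_add _ _ _
          _ = (rightSMul k R2 M1 M2 r2) (r1 • x) + (rightSMul k R2 M1 M2 r2) (r1 • y) := by
              rw [hx, hy]
          _ = (rightSMul k R2 M1 M2 r2) (r1 • x + r1 • y) :=
              ((rightSMul k R2 M1 M2 r2).map_add _ _).symm
          _ = (rightSMul k R2 M1 M2 r2) (r1 • (x + y)) := by rw [smul_add]
  TensorProduct.Algebra.module

/-- The defining property of the `R1 ⊗[k] R2`-module structure on `M1 ⊗[k] M2`. -/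
lemma tensorModule_smul_tmul (r1 : R1) (r2 : R2) (m : M1) (n : M2) :
    (r1 ⊗ₜ[k] r2 : R1 ⊗[k] R2) • (m ⊗ₜ[k] n : M1 ⊗[k] M2) = (r1 • m) ⊗ₜ[k] (r2 • n) := rfl

end TensorModule

section HomAlg

variable (R : Type) [CommRing R]

/-- The `i`-th Ext group `Ext_R^i(M, N)`. -/
noncomputable def extGroup (M N : Type) [AddCommGroup M] [Module R M]
    [AddCommGroup N] [Module R N] (i : ℕ) : Type :=
  (((Ext R (ModuleCat R) i).obj (Opposite.op (ModuleCat.of R M))).obj (ModuleCat.of R N) :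
    ModuleCat R)

/-- The `i`-th Tor group `Tor_i^R(M, N)`. -/
noncomputable def torGroup (M N : Type) [AddCommGroup M] [Module R M]
    [AddCommGroup N] [Module R N] (i : ℕ) : Type :=
  (((Tor (ModuleCat R) i).obj (ModuleCat.of R M)).obj (ModuleCat.of R N) : ModuleCat R)

/-- `C` is a semidualizing `R`-module: it is finitely generated, the homothety map
`R → Hom_R(C,C)`, `r ↦ (x ↦ r • x)`, is bijective, and `Ext_R^i(C,C) = 0` for all `i > 0`. -/
noncomputable def IsSemidualizing (C : Type) [AddCommGroup C] [Module R C] : Prop :=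
  Module.Finite R C ∧
  Function.Bijective (LinearMap.lsmul R C) ∧
  ∀ i : ℕ, 0 < i → Subsingleton (extGroup R C C i)

end HomAlg

section BassAuslander

open TensorProduct

variable (R : Type) [CommRing R]

/-- `M` belongs to the Bass class `B_C(R)`: the evaluation map
`C ⊗_R Hom_R(C,M) → M`, `c ⊗ f ↦ f c`, is bijective, and
`Ext_R^i(C,M) = 0 = Tor_i^R(C, Hom_R(C,M))` for all `i > 0`. -/
noncomputable def MemBassClass (C M : Type) [AddCommGroup C] [Module R C]
    [AddCommGroup M] [Module R M] : Prop :=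
  Function.Bijective (TensorProduct.lift
    ((LinearMap.id : (C →ₗ[R] M) →ₗ[R] (C →ₗ[R] M)).flip) : C ⊗[R] (C →ₗ[R] M) → M) ∧
  (∀ i : ℕ, 0 < i → Subsingleton (extGroup R C M i)) ∧
  (∀ i : ℕ, 0 < i → Subsingleton (torGroup R C (C →ₗ[R] M) i))

end BassAuslander

section VanishingTheory

variable (R : Type) [CommRing R]

theorem subsingleton_extGroup_iff (M N : Type) [AddCommGroup M] [Module R M]
    [AddCommGroup N] [Module R N] (n : ℕ) :
    Subsingleton (extGroup R M N (n + 1)) ↔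
      Subsingleton (Abelian.Ext (ModuleCat.of R M) (ModuleCat.of R N) (n + 1)) := by
  let P := ProjectiveResolution.of (ModuleCat.of R M)
  have e : extGroup R M N (n + 1) ≃
      ((P.complex.linearYonedaObj R (ModuleCat.of R N)).homology (n + 1) : ModuleCat R) :=
    ((P.isoExt (n + 1) (ModuleCat.of R N))).toLinearEquiv.toEquiv
  rw [e.subsingleton_congr, ← ModuleCat.isZero_iff_subsingleton,
    ← HomologicalComplex.exactAt_iff_isZero_homology,
    HomologicalComplex.exactAt_iff' _ n (n + 1) (n + 2) (by simp) (by simp),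
    ShortComplex.moduleCat_exact_iff]
  constructor
  · intro h
    refine subsingleton_of_forall_eq 0 fun x => ?_
    obtain ⟨f, hf, rfl⟩ := P.extMk_surjective x (n + 2) rfl
    rw [P.extMk_eq_zero_iff f (n + 2) rfl hf n rfl]
    obtain ⟨g, hg⟩ := h f (hf)
    exact ⟨g, hg⟩
  · intro h f hf
    obtain ⟨g, hg⟩ := (P.extMk_eq_zero_iff f (n + 2) rfl (hf) n rfl).1
      (Subsingleton.elim _ _)
    exact ⟨g, hg⟩

variable {R} in
/-- The sequence `0 → X → Y → Z → 0` given by `f` and `g` is exact. -/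
structure IsShortExact {X Y Z : Type} [AddCommGroup X] [Module R X] [AddCommGroup Y] [Module R Y]
    [AddCommGroup Z] [Module R Z] (f : X →ₗ[R] Y) (g : Y →ₗ[R] Z) : Prop where
  injective : Function.Injective f
  exact : Function.Exact f g
  surjective : Function.Surjective g

/-- A family of vanishing conditions on `R`-modules, indexed by the positive degrees (`vanish n`
refers to degree `n + 1`), that behaves like the vanishing of a sequence of derived functors in a
variable resolved by projectives; `good f` says that, in degree zero, the functor sends the
injective map `f` to a surjective (contravariant case) or injective (covariant case) map. -/
structure VanishingTheory where
  vanish : ℕ → ∀ (X : Type) [AddCommGroup X] [Module R X], Prop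
  good : ∀ {X Y : Type} [AddCommGroup X] [Module R X] [AddCommGroup Y] [Module R Y],
    (X →ₗ[R] Y) → Prop
  vanish_of_projective : ∀ (n : ℕ) (X : Type) [AddCommGroup X] [Module R X]
    [Module.Projective R X], vanish n X
  vanish_zero : ∀ {X Y Z : Type} [AddCommGroup X] [Module R X] [AddCommGroup Y] [Module R Y]
    [AddCommGroup Z] [Module R Z] {f : X →ₗ[R] Y} {g : Y →ₗ[R] Z},
    IsShortExact f g → good f → vanish 0 Y → vanish 0 Z
  good_of_vanish_zero : ∀ {X Y Z : Type} [AddCommGroup X] [Module R X] [AddCommGroup Y] [Module R Y]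
    [AddCommGroup Z] [Module R Z] {f : X →ₗ[R] Y} {g : Y →ₗ[R] Z},
    IsShortExact f g → vanish 0 Z → good f
  vanish_succ : ∀ {n : ℕ} {X Y Z : Type} [AddCommGroup X] [Module R X] [AddCommGroup Y] [Module R Y]
    [AddCommGroup Z] [Module R Z] {f : X →ₗ[R] Y} {g : Y →ₗ[R] Z},
    IsShortExact f g → vanish n X → vanish (n + 1) Y → vanish (n + 1) Z
  vanish_of_succ : ∀ {n : ℕ} {X Y Z : Type} [AddCommGroup X] [Module R X] [AddCommGroup Y] [Module R Y]
    [AddCommGroup Z] [Module R Z] {f : X →ₗ[R] Y} {g : Y →ₗ[R] Z},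
    IsShortExact f g → vanish (n + 1) Z → vanish n Y → vanish n X

section

variable {R} {X Y Z : Type} [AddCommGroup X] [Module R X] [AddCommGroup Y] [Module R Y]
    [AddCommGroup Z] [Module R Z]

theorem IsShortExact.exists_moduleCat {f : X →ₗ[R] Y} {g : Y →ₗ[R] Z} (h : IsShortExact f g) :
    ∃ w, (ShortComplex.mk (ModuleCat.ofHom f) (ModuleCat.ofHom g) w).ShortExact := by
  refine ⟨by ext x; exact h.exact.apply_apply_eq_zero x,
    { exact := ?_
      mono_f := (ModuleCat.mono_iff_injective _).2 h.injective
      epi_g := (ModuleCat.epi_iff_surjective _).2 h.surjective }⟩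
  rw [ShortComplex.moduleCat_exact_iff]
  exact fun x hx => (h.exact x).1 hx

end

/-- The vanishing of `Ext_R^(n+1)(-, N)`. -/
noncomputable def extVanishing (N : Type) [AddCommGroup N] [Module R N] : VanishingTheory R where
  vanish n X _ _ := Subsingleton (extGroup R X N (n + 1))
  good {X Y} _ _ _ _ f := ∀ h : X →ₗ[R] N, ∃ h' : Y →ₗ[R] N, h' ∘ₗ f = h
  vanish_of_projective n X _ _ _ := by
    have : Projective (ModuleCat.of R X) :=
      (IsProjective.iff_projective (R := R) X).1 inferInstance
    rw [subsingleton_extGroup_iff]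
    exact subsingleton_of_forall_eq 0 fun x => Abelian.Ext.eq_zero_of_projective _
  vanish_zero {X Y Z} _ _ _ _ _ _ {f g} h H hY := by
    obtain ⟨w, hS⟩ := h.exists_moduleCat
    rw [subsingleton_extGroup_iff] at hY ⊢
    refine subsingleton_of_forall_eq 0 fun x => ?_
    obtain ⟨x₁, rfl⟩ := Abelian.Ext.contravariant_sequence_exact₃ hS _ x
      (hY.elim _ _) (n₀ := 0) rfl
    obtain ⟨u, rfl⟩ := Abelian.Ext.mk₀_bijective _ _ |>.2 x₁
    obtain ⟨v, hv⟩ := H u.hom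
    obtain rfl : ModuleCat.ofHom f ≫ ModuleCat.ofHom v = u := by
      ext1; exact hv
    rw [← Abelian.Ext.mk₀_comp_mk₀]
    exact hS.extClass_comp_assoc _
  good_of_vanish_zero {X Y Z} _ _ _ _ _ _ {f g} h hZ u := by
    obtain ⟨w, hS⟩ := h.exists_moduleCat
    rw [subsingleton_extGroup_iff] at hZ
    obtain ⟨v, hv⟩ := Abelian.Ext.contravariant_sequence_exact₁ hS (ModuleCat.of R N)
      (Abelian.Ext.mk₀ (ModuleCat.ofHom u)) (n₁ := 1) rfl (hZ.elim _ _)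
    obtain ⟨v, rfl⟩ := Abelian.Ext.mk₀_bijective _ _ |>.2 v
    rw [Abelian.Ext.mk₀_comp_mk₀] at hv
    exact ⟨v.hom, congrArg ModuleCat.Hom.hom ((Abelian.Ext.mk₀_bijective _ _).1 hv)⟩
  vanish_succ {n X Y Z} _ _ _ _ _ _ {f g} h hX hY := by
    obtain ⟨w, hS⟩ := h.exists_moduleCat
    rw [subsingleton_extGroup_iff] at hX hY ⊢
    refine subsingleton_of_forall_eq 0 fun x => ?_
    obtain ⟨x₁, rfl⟩ := Abelian.Ext.contravariant_sequence_exact₃ hS _ x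
      (hY.elim _ _) (n₀ := n + 1) (by omega)
    rw [hX.elim x₁ 0, Abelian.Ext.comp_zero]
  vanish_of_succ {n X Y Z} _ _ _ _ _ _ {f g} h hX hY := by
    obtain ⟨w, hS⟩ := h.exists_moduleCat
    rw [subsingleton_extGroup_iff] at hX hY ⊢
    refine subsingleton_of_forall_eq 0 fun x => ?_
    obtain ⟨x₁, rfl⟩ := Abelian.Ext.contravariant_sequence_exact₁ hS _ x
      (n₁ := n + 2) (by omega) (hX.elim _ _)
    rw [hY.elim x₁ 0, Abelian.Ext.comp_zero]

end VanishingTheory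

section Chase

variable {R : Type} [CommRing R] {X₀ X₁ X₂ Y₀ Y₁ Y₂ Y₃ Z₁ Z₂ Z₃ : Type}
  [AddCommGroup X₀] [Module R X₀] [AddCommGroup X₁] [Module R X₁] [AddCommGroup X₂] [Module R X₂]
  [AddCommGroup Y₀] [Module R Y₀] [AddCommGroup Y₁] [Module R Y₁] [AddCommGroup Y₂] [Module R Y₂]
  [AddCommGroup Y₃] [Module R Y₃] [AddCommGroup Z₁] [Module R Z₁] [AddCommGroup Z₂] [Module R Z₂]
  [AddCommGroup Z₃] [Module R Z₃]

theorem exact_right_of_exact_left_of_exact_middle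
    {a₁ : X₁ →ₗ[R] X₀} {a₂ : X₂ →ₗ[R] X₁} {b₁ : Y₁ →ₗ[R] Y₀} {b₂ : Y₂ →ₗ[R] Y₁}
    {b₃ : Y₃ →ₗ[R] Y₂} {c₂ : Z₂ →ₗ[R] Z₁} {c₃ : Z₃ →ₗ[R] Z₂}
    {f₀ : X₀ →ₗ[R] Y₀} {f₁ : X₁ →ₗ[R] Y₁} {f₂ : X₂ →ₗ[R] Y₂}
    {g₁ : Y₁ →ₗ[R] Z₁} {g₂ : Y₂ →ₗ[R] Z₂} {g₃ : Y₃ →ₗ[R] Z₃}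
    (hf₁ : f₀ ∘ₗ a₁ = b₁ ∘ₗ f₁) (hf₂ : f₁ ∘ₗ a₂ = b₂ ∘ₗ f₂)
    (hg₂ : g₁ ∘ₗ b₂ = c₂ ∘ₗ g₂) (hg₃ : g₂ ∘ₗ b₃ = c₃ ∘ₗ g₃)
    (hc : c₂ ∘ₗ c₃ = 0) (hb : b₁ ∘ₗ b₂ = 0)
    (h₀ : Function.Injective f₀) (h₁ : Function.Exact f₁ g₁) (h₂ : g₂ ∘ₗ f₂ = 0)
    (s₂ : Function.Surjective g₂) (hX : Function.Exact a₂ a₁) (hY : Function.Exact b₃ b₂) :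
    Function.Exact c₃ c₂ := by
  rw [LinearMap.ext_iff] at hf₁ hf₂ hg₂ hg₃ hc hb h₂
  simp only [LinearMap.comp_apply, LinearMap.zero_apply] at hf₁ hf₂ hg₂ hg₃ hc hb h₂
  refine fun z => ⟨fun hz => ?_, ?_⟩
  · obtain ⟨y, rfl⟩ := s₂ z
    obtain ⟨x, hx⟩ := (h₁ (b₂ y)).1 (by rw [hg₂, hz])
    obtain ⟨w, rfl⟩ := (hX x).1 (h₀ (by rw [hf₁, hx, hb, map_zero]))
    obtain ⟨y', hy'⟩ := (hY (y - f₂ w)).1 (by rw [map_sub, ← hx, hf₂, sub_self])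
    exact ⟨g₃ y', by rw [← hg₃, hy', map_sub, h₂, sub_zero]⟩
  · rintro ⟨w, rfl⟩
    exact hc w

theorem exact_left_of_exact_right_of_exact_middle
    {a₁ : X₁ →ₗ[R] X₀} {a₂ : X₂ →ₗ[R] X₁} {b₁ : Y₁ →ₗ[R] Y₀} {b₂ : Y₂ →ₗ[R] Y₁}
    {b₃ : Y₃ →ₗ[R] Y₂} {c₂ : Z₂ →ₗ[R] Z₁} {c₃ : Z₃ →ₗ[R] Z₂}
    {f₀ : X₀ →ₗ[R] Y₀} {f₁ : X₁ →ₗ[R] Y₁} {f₂ : X₂ →ₗ[R] Y₂}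
    {g₁ : Y₁ →ₗ[R] Z₁} {g₂ : Y₂ →ₗ[R] Z₂} {g₃ : Y₃ →ₗ[R] Z₃}
    (hf₁ : f₀ ∘ₗ a₁ = b₁ ∘ₗ f₁) (hf₂ : f₁ ∘ₗ a₂ = b₂ ∘ₗ f₂)
    (hg₂ : g₁ ∘ₗ b₂ = c₂ ∘ₗ g₂) (hg₃ : g₂ ∘ₗ b₃ = c₃ ∘ₗ g₃)
    (ha : a₁ ∘ₗ a₂ = 0) (hb : b₂ ∘ₗ b₃ = 0)
    (i₁ : Function.Injective f₁) (h₁ : g₁ ∘ₗ f₁ = 0) (h₂ : Function.Exact f₂ g₂)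
    (s₃ : Function.Surjective g₃) (hZ : Function.Exact c₃ c₂) (hY : Function.Exact b₂ b₁) :
    Function.Exact a₂ a₁ := by
  rw [LinearMap.ext_iff] at hf₁ hf₂ hg₂ hg₃ ha hb h₁
  simp only [LinearMap.comp_apply, LinearMap.zero_apply] at hf₁ hf₂ hg₂ hg₃ ha hb h₁
  refine fun x => ⟨fun hx => ?_, ?_⟩
  · obtain ⟨y, hy⟩ := (hY (f₁ x)).1 (by rw [← hf₁, hx, map_zero])
    obtain ⟨z, hz⟩ := (hZ (g₂ y)).1 (by rw [← hg₂, hy, h₁])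
    obtain ⟨w, rfl⟩ := s₃ z
    obtain ⟨v, hv⟩ := (h₂ (y - b₃ w)).1 (by rw [map_sub, hg₃, hz, sub_self])
    exact ⟨v, i₁ (by rw [hf₂, hv, map_sub, hb, sub_zero, hy])⟩
  · rintro ⟨w, rfl⟩
    exact ha w

theorem injective_left_of_exact_right_of_exact_middle
    {a₁ : X₁ →ₗ[R] X₀} {a₂ : X₂ →ₗ[R] X₁} {b₁ : Y₁ →ₗ[R] Y₀} {b₂ : Y₂ →ₗ[R] Y₁}
    {b₃ : Y₃ →ₗ[R] Y₂} {c₂ : Z₂ →ₗ[R] Z₁} {c₃ : Z₃ →ₗ[R] Z₂}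
    {f₀ : X₀ →ₗ[R] Y₀} {f₁ : X₁ →ₗ[R] Y₁} {f₂ : X₂ →ₗ[R] Y₂}
    {g₁ : Y₁ →ₗ[R] Z₁} {g₂ : Y₂ →ₗ[R] Z₂} {g₃ : Y₃ →ₗ[R] Z₃}
    (hf₁ : f₀ ∘ₗ a₁ = b₁ ∘ₗ f₁) (hf₂ : f₁ ∘ₗ a₂ = b₂ ∘ₗ f₂)
    (hg₂ : g₁ ∘ₗ b₂ = c₂ ∘ₗ g₂) (hg₃ : g₂ ∘ₗ b₃ = c₃ ∘ₗ g₃)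
    (ha : a₁ ∘ₗ a₂ = 0) (hb : b₂ ∘ₗ b₃ = 0)
    (i₁ : Function.Injective f₁) (h₁ : g₁ ∘ₗ f₁ = 0) (h₂ : Function.Exact f₂ g₂)
    (s₃ : Function.Surjective g₃) (hZ : Function.Exact c₃ c₂) (hY : Function.Exact b₂ b₁)
    (t₁ : Function.Surjective a₁) : Function.Injective f₀ := by
  have h : Function.Exact a₂ (f₀ ∘ₗ a₁) :=
    exact_left_of_exact_right_of_exact_middle (f₀ := LinearMap.id) hf₁ hf₂ hg₂ hg₃
      (by rw [LinearMap.comp_assoc, ha, LinearMap.comp_zero]) hb i₁ h₁ h₂ s₃ hZ hY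
  refine (injective_iff_map_eq_zero _).2 fun x hx => ?_
  obtain ⟨w, rfl⟩ := t₁ x
  obtain ⟨v, rfl⟩ := (h w).1 hx
  exact LinearMap.congr_fun ha v

end Chase

section Tor

variable {R : Type} [CommRing R]

theorem subsingleton_torGroup_iff (M : Type) {N : Type} [AddCommGroup M] [Module R M]
    [AddCommGroup N] [Module R N] (P : ProjectiveResolution (ModuleCat.of R N)) (n : ℕ) :
    Subsingleton (torGroup R M N (n + 1)) ↔
      Function.Exact ((P.complex.d (n + 2) (n + 1)).hom.lTensor M)
        ((P.complex.d (n + 1) n).hom.lTensor M) := by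
  let F := (MonoidalCategory.tensoringLeft (ModuleCat R)).obj (ModuleCat.of R M)
  have e : torGroup R M N (n + 1) ≃
      (((F.mapHomologicalComplex _).obj P.complex).homology (n + 1) : ModuleCat R) :=
    (P.isoLeftDerivedObj F (n + 1)).toLinearEquiv.toEquiv
  rw [e.subsingleton_congr, ← ModuleCat.isZero_iff_subsingleton,
    ← HomologicalComplex.exactAt_iff_isZero_homology,
    HomologicalComplex.exactAt_iff' _ (n + 2) (n + 1) n (by simp) (by simp),
    ShortComplex.ShortExact.moduleCat_exact_iff_function_exact]
  rfl

theorem subsingleton_torGroup_congr (M : Type) {N N' : Type} [AddCommGroup M] [Module R M]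
    [AddCommGroup N] [Module R N] [AddCommGroup N'] [Module R N'] (e : N ≃ₗ[R] N') (n : ℕ) :
    Subsingleton (torGroup R M N n) ↔ Subsingleton (torGroup R M N' n) :=
  (((Tor (ModuleCat R) n).obj (ModuleCat.of R M)).mapIso
    e.toModuleIso).toLinearEquiv.toEquiv.subsingleton_congr


theorem exists_augmentation {N : Type} [AddCommGroup N] [Module R N]
    (P : ProjectiveResolution (ModuleCat.of R N)) :
    ∃ p : P.complex.X 0 →ₗ[R] N, Function.Exact (P.complex.d 1 0).hom p ∧
      Function.Surjective p :=
  ⟨(P.π.f 0).hom,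
    (ShortComplex.ShortExact.moduleCat_exact_iff_function_exact _).1 P.exact₀,
    (ModuleCat.epi_iff_surjective (P.π.f 0)).1 inferInstance⟩

theorem lTensor_d_comp_lTensor_d (M : Type) [AddCommGroup M] [Module R M]
    (P : ChainComplex (ModuleCat R) ℕ) (i j l : ℕ) :
    (P.d j l).hom.lTensor M ∘ₗ (P.d i j).hom.lTensor M = 0 := by
  rw [← LinearMap.lTensor_comp, ← ModuleCat.hom_comp, P.d_comp_d, ModuleCat.hom_zero,
    LinearMap.lTensor_zero]

instance (C : ModuleCat R) [Projective C] : Module.Projective R C :=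
  (IsProjective.iff_projective (R := R) C).2 ‹_›

theorem rTensor_comp_lTensor_comm {X Y P Q : Type} [AddCommGroup X] [Module R X]
    [AddCommGroup Y] [Module R Y] [AddCommGroup P] [Module R P] [AddCommGroup Q] [Module R Q]
    (f : X →ₗ[R] Y) (d : P →ₗ[R] Q) :
    f.rTensor Q ∘ₗ d.lTensor X = d.lTensor Y ∘ₗ f.rTensor P := by
  rw [LinearMap.rTensor_comp_lTensor, LinearMap.lTensor_comp_rTensor]

theorem rTensor_comp_rTensor_eq_zero (P : Type) [AddCommGroup P] [Module R P] {X Y Z : Type}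
    [AddCommGroup X] [Module R X] [AddCommGroup Y] [Module R Y] [AddCommGroup Z] [Module R Z]
    {f : X →ₗ[R] Y} {g : Y →ₗ[R] Z} (h : Function.Exact f g) :
    g.rTensor P ∘ₗ f.rTensor P = 0 := by
  rw [← LinearMap.rTensor_comp, h.linearMap_comp_eq_zero, LinearMap.rTensor_zero]

variable (R)

/-- The vanishing of `Tor^R_(n+1)(-, N)`. -/
noncomputable def torVanishing (N : Type) [AddCommGroup N] [Module R N] : VanishingTheory R where
  vanish n X _ _ := Subsingleton (torGroup R X N (n + 1))
  good {X Y} _ _ _ _ f := Function.Injective (f.rTensor N)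
  vanish_of_projective n X _ _ _ := by
    let P := ProjectiveResolution.of (ModuleCat.of R N)
    rw [subsingleton_torGroup_iff X P]
    exact Module.Flat.lTensor_exact X
      ((ShortComplex.ShortExact.moduleCat_exact_iff_function_exact _).1 (P.exact_succ n))
  vanish_zero {X Y Z} _ _ _ _ _ _ {f g} h H hY := by
    let P := ProjectiveResolution.of (ModuleCat.of R N)
    obtain ⟨p, hp, hp'⟩ := exists_augmentation P
    rw [subsingleton_torGroup_iff _ P] at hY ⊢
    exact exact_right_of_exact_left_of_exact_middle (b₁ := p.lTensor Y)
      (rTensor_comp_lTensor_comm f p)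
      (rTensor_comp_lTensor_comm f (P.complex.d 1 0).hom)
      (rTensor_comp_lTensor_comm g (P.complex.d 1 0).hom)
      (rTensor_comp_lTensor_comm g (P.complex.d 2 1).hom)
      (lTensor_d_comp_lTensor_d _ _ _ _ _)
      (by rw [← LinearMap.lTensor_comp, hp.linearMap_comp_eq_zero, LinearMap.lTensor_zero])
      H (rTensor_exact _ h.exact h.surjective) (rTensor_comp_rTensor_eq_zero _ h.exact)
      (LinearMap.rTensor_surjective _ h.surjective) (lTensor_exact X hp hp') hY
  good_of_vanish_zero {X Y Z} _ _ _ _ _ _ {f g} h hZ := by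
    let P := ProjectiveResolution.of (ModuleCat.of R N)
    obtain ⟨p, hp, hp'⟩ := exists_augmentation P
    rw [subsingleton_torGroup_iff _ P] at hZ
    exact injective_left_of_exact_right_of_exact_middle
      (rTensor_comp_lTensor_comm f p)
      (rTensor_comp_lTensor_comm f (P.complex.d 1 0).hom)
      (rTensor_comp_lTensor_comm g (P.complex.d 1 0).hom)
      (rTensor_comp_lTensor_comm g (P.complex.d 2 1).hom)
      (by rw [← LinearMap.lTensor_comp, hp.linearMap_comp_eq_zero, LinearMap.lTensor_zero])
      (lTensor_d_comp_lTensor_d _ _ _ _ _)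
      (Module.Flat.rTensor_preserves_injective_linearMap _ h.injective)
      (rTensor_comp_rTensor_eq_zero _ h.exact) (rTensor_exact _ h.exact h.surjective)
      (LinearMap.rTensor_surjective _ h.surjective) hZ (lTensor_exact Y hp hp')
      (LinearMap.lTensor_surjective X hp')
  vanish_succ {n X Y Z} _ _ _ _ _ _ {f g} h hX hY := by
    let P := ProjectiveResolution.of (ModuleCat.of R N)
    rw [subsingleton_torGroup_iff _ P] at hX hY ⊢
    exact exact_right_of_exact_left_of_exact_middle
      (rTensor_comp_lTensor_comm f (P.complex.d (n + 1) n).hom)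
      (rTensor_comp_lTensor_comm f (P.complex.d (n + 2) (n + 1)).hom)
      (rTensor_comp_lTensor_comm g (P.complex.d (n + 2) (n + 1)).hom)
      (rTensor_comp_lTensor_comm g (P.complex.d (n + 3) (n + 2)).hom)
      (lTensor_d_comp_lTensor_d _ _ _ _ _) (lTensor_d_comp_lTensor_d _ _ _ _ _)
      (Module.Flat.rTensor_preserves_injective_linearMap _ h.injective)
      (rTensor_exact _ h.exact h.surjective) (rTensor_comp_rTensor_eq_zero _ h.exact)
      (LinearMap.rTensor_surjective _ h.surjective) hX hY
  vanish_of_succ {n X Y Z} _ _ _ _ _ _ {f g} h hZ hY := by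
    let P := ProjectiveResolution.of (ModuleCat.of R N)
    rw [subsingleton_torGroup_iff _ P] at hZ hY ⊢
    exact exact_left_of_exact_right_of_exact_middle
      (rTensor_comp_lTensor_comm f (P.complex.d (n + 1) n).hom)
      (rTensor_comp_lTensor_comm f (P.complex.d (n + 2) (n + 1)).hom)
      (rTensor_comp_lTensor_comm g (P.complex.d (n + 2) (n + 1)).hom)
      (rTensor_comp_lTensor_comm g (P.complex.d (n + 3) (n + 2)).hom)
      (lTensor_d_comp_lTensor_d _ _ _ _ _) (lTensor_d_comp_lTensor_d _ _ _ _ _)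
      (Module.Flat.rTensor_preserves_injective_linearMap _ h.injective)
      (rTensor_comp_rTensor_eq_zero _ h.exact) (rTensor_exact _ h.exact h.surjective)
      (LinearMap.rTensor_surjective _ h.surjective) hZ hY

end Tor

section TensorMap

variable {k : Type} [Field k] {R1 R2 : Type} [CommRing R1] [CommRing R2]
  [Algebra k R1] [Algebra k R2]

section

variable {X Y X' Y' : Type}
  [AddCommGroup X] [Module k X] [Module R1 X] [IsScalarTower k R1 X]
  [AddCommGroup Y] [Module k Y] [Module R2 Y] [IsScalarTower k R2 Y]
  [AddCommGroup X'] [Module k X'] [Module R1 X'] [IsScalarTower k R1 X']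
  [AddCommGroup Y'] [Module k Y'] [Module R2 Y'] [IsScalarTower k R2 Y']

instance tensorModule_isScalarTower : IsScalarTower k (R1 ⊗[k] R2) (X ⊗[k] Y) := by
  refine ⟨fun c r m => ?_⟩
  induction r with
  | zero => simp
  | add a b ha hb => rw [smul_add, add_smul, ha, hb, add_smul, smul_add]
  | tmul a b =>
    induction m with
    | zero => simp
    | add m n hm hn => rw [smul_add, hm, hn, smul_add, smul_add]
    | tmul x y =>
      rw [smul_tmul', tensorModule_smul_tmul, tensorModule_smul_tmul, smul_tmul', smul_assoc]

/-- A `k`-linear map out of `X ⊗[k] Y` that is compatible with the actions of pure tensors on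
pure tensors, as an `R1 ⊗[k] R2`-linear map. -/
noncomputable def tensorLift {Z : Type} [AddCommGroup Z] [Module k Z] [Module (R1 ⊗[k] R2) Z]
    (φ : X ⊗[k] Y →ₗ[k] Z)
    (h : ∀ (a : R1) (b : R2) (x : X) (y : Y),
      φ ((a • x) ⊗ₜ (b • y)) = (a ⊗ₜ[k] b : R1 ⊗[k] R2) • φ (x ⊗ₜ y)) :
    X ⊗[k] Y →ₗ[R1 ⊗[k] R2] Z where
  __ := φ
  map_smul' r m := by
    change φ (r • m) = r • φ m
    induction r with
    | zero => simp
    | add a b ha hb => rw [add_smul, map_add, ha, hb, add_smul]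
    | tmul a b =>
      induction m with
      | zero => simp
      | add m n hm hn => rw [smul_add, map_add, hm, hn, map_add, smul_add]
      | tmul x y => rw [tensorModule_smul_tmul, h]

@[simp]
theorem tensorLift_apply {Z : Type} [AddCommGroup Z] [Module k Z] [Module (R1 ⊗[k] R2) Z]
    (φ : X ⊗[k] Y →ₗ[k] Z) (h) (t : X ⊗[k] Y) :
    tensorLift (R1 := R1) (R2 := R2) φ h t = φ t := rfl

/-- The `R1 ⊗[k] R2`-linear map `f ⊗ g`. -/
noncomputable def tensorMap (f : X →ₗ[R1] X') (g : Y →ₗ[R2] Y') :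
    X ⊗[k] Y →ₗ[R1 ⊗[k] R2] X' ⊗[k] Y' :=
  tensorLift (TensorProduct.map (f.restrictScalars k) (g.restrictScalars k)) fun a b x y => by
    simp [tensorModule_smul_tmul]

@[simp]
theorem tensorMap_tmul (f : X →ₗ[R1] X') (g : Y →ₗ[R2] Y') (x : X) (y : Y) :
    tensorMap (k := k) f g (x ⊗ₜ y) = f x ⊗ₜ g y := rfl

theorem tensorProduct_hom_ext {Z : Type} [AddCommGroup Z] [Module (R1 ⊗[k] R2) Z]
    {f g : X ⊗[k] Y →ₗ[R1 ⊗[k] R2] Z} (h : ∀ x y, f (x ⊗ₜ y) = g (x ⊗ₜ y)) : f = g := by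
  ext t
  induction t with
  | zero => simp
  | add a b ha hb => rw [map_add, map_add, ha, hb]
  | tmul x y => exact h x y

end

instance tensorProduct_pi_projective (m n : ℕ) :
    Module.Projective (R1 ⊗[k] R2) ((Fin m → R1) ⊗[k] (Fin n → R2)) := by
  let c (i : Fin m) (j : Fin n) : (Fin m → R1) ⊗[k] (Fin n → R2) →ₗ[R1 ⊗[k] R2] R1 ⊗[k] R2 :=
    tensorLift (TensorProduct.map (LinearMap.proj i) (LinearMap.proj j)) fun a b x y => by simp
  let v (p : Fin m × Fin n) : (Fin m → R1) ⊗[k] (Fin n → R2) :=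
    Pi.single p.1 1 ⊗ₜ Pi.single p.2 1
  refine Module.Projective.of_split (M := Fin m × Fin n → R1 ⊗[k] R2)
    (LinearMap.pi fun p => c p.1 p.2) (Fintype.linearCombination (R1 ⊗[k] R2) v) ?_
  refine tensorProduct_hom_ext fun x y => ?_
  conv_rhs => rw [LinearMap.id_apply, pi_eq_sum_univ' x, pi_eq_sum_univ' y]
  simp only [LinearMap.comp_apply, Fintype.linearCombination_apply, Fintype.sum_prod_type,
    tmul_sum, sum_tmul, v, LinearMap.pi_apply]
  rw [Finset.sum_comm]
  rfl

end TensorMap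

section Kunneth

variable (k : Type) [Field k] {R1 R2 : Type} [CommRing R1] [CommRing R2]
  [Algebra k R1] [Algebra k R2]

/-- The degree zero part of a Künneth formula relating vanishing theories over `R1`, `R2` and
`R1 ⊗[k] R2`. The predicates `p1` and `p2` single out modules on which the degree zero functors
do not vanish. -/
structure KunnethCompatible (D1 : VanishingTheory R1) (D2 : VanishingTheory R2)
    (D : VanishingTheory (R1 ⊗[k] R2))
    (p1 : ∀ (X : Type) [AddCommGroup X] [Module R1 X], Prop)
    (p2 : ∀ (Y : Type) [AddCommGroup Y] [Module R2 Y], Prop) : Prop where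
  good_left : ∀ {X X' : Type} (Y : Type)
    [AddCommGroup X] [Module k X] [Module R1 X] [IsScalarTower k R1 X] [Module.Finite R1 X]
    [AddCommGroup X'] [Module k X'] [Module R1 X'] [IsScalarTower k R1 X'] [Module.Finite R1 X']
    [AddCommGroup Y] [Module k Y] [Module R2 Y] [IsScalarTower k R2 Y] [Module.Finite R2 Y]
    (f : X →ₗ[R1] X'), D1.good f → D.good (tensorMap (k := k) f (LinearMap.id : Y →ₗ[R2] Y))
  good_right : ∀ (X : Type) {Y Y' : Type}
    [AddCommGroup X] [Module k X] [Module R1 X] [IsScalarTower k R1 X] [Module.Finite R1 X]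
    [AddCommGroup Y] [Module k Y] [Module R2 Y] [IsScalarTower k R2 Y] [Module.Finite R2 Y]
    [AddCommGroup Y'] [Module k Y'] [Module R2 Y'] [IsScalarTower k R2 Y'] [Module.Finite R2 Y']
    (g : Y →ₗ[R2] Y'), D2.good g → D.good (tensorMap (k := k) (LinearMap.id : X →ₗ[R1] X) g)
  of_good_left : ∀ {X X' : Type} (Y : Type)
    [AddCommGroup X] [Module k X] [Module R1 X] [IsScalarTower k R1 X] [Module.Finite R1 X]
    [AddCommGroup X'] [Module k X'] [Module R1 X'] [IsScalarTower k R1 X'] [Module.Finite R1 X']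
    [AddCommGroup Y] [Module k Y] [Module R2 Y] [IsScalarTower k R2 Y] [Module.Finite R2 Y]
    (f : X →ₗ[R1] X'), p2 Y → D.good (tensorMap (k := k) f (LinearMap.id : Y →ₗ[R2] Y)) →
    D1.good f
  of_good_right : ∀ (X : Type) {Y Y' : Type}
    [AddCommGroup X] [Module k X] [Module R1 X] [IsScalarTower k R1 X] [Module.Finite R1 X]
    [AddCommGroup Y] [Module k Y] [Module R2 Y] [IsScalarTower k R2 Y] [Module.Finite R2 Y]
    [AddCommGroup Y'] [Module k Y'] [Module R2 Y'] [IsScalarTower k R2 Y'] [Module.Finite R2 Y']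
    (g : Y →ₗ[R2] Y'), p1 X → D.good (tensorMap (k := k) (LinearMap.id : X →ₗ[R1] X) g) →
    D2.good g

variable {k}

section Exact

variable {X X' X'' Y Y' Y'' : Type}
  [AddCommGroup X] [Module k X] [Module R1 X] [IsScalarTower k R1 X]
  [AddCommGroup X'] [Module k X'] [Module R1 X'] [IsScalarTower k R1 X']
  [AddCommGroup X''] [Module k X''] [Module R1 X''] [IsScalarTower k R1 X'']
  [AddCommGroup Y] [Module k Y] [Module R2 Y] [IsScalarTower k R2 Y]
  [AddCommGroup Y'] [Module k Y'] [Module R2 Y'] [IsScalarTower k R2 Y']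
  [AddCommGroup Y''] [Module k Y''] [Module R2 Y''] [IsScalarTower k R2 Y'']

theorem IsShortExact.tensor_right (Y : Type) [AddCommGroup Y] [Module k Y] [Module R2 Y]
    [IsScalarTower k R2 Y] {f : X →ₗ[R1] X'} {g : X' →ₗ[R1] X''} (h : IsShortExact f g) :
    IsShortExact (tensorMap (k := k) f (LinearMap.id : Y →ₗ[R2] Y))
      (tensorMap (k := k) g (LinearMap.id : Y →ₗ[R2] Y)) where
  injective := Module.Flat.rTensor_preserves_injective_linearMap (f.restrictScalars k) h.injective
  exact := rTensor_exact (f := f.restrictScalars k) (g := g.restrictScalars k) Y h.exact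
    h.surjective
  surjective := LinearMap.rTensor_surjective (g := g.restrictScalars k) Y h.surjective

theorem IsShortExact.tensor_left (X : Type) [AddCommGroup X] [Module k X] [Module R1 X]
    [IsScalarTower k R1 X] {f : Y →ₗ[R2] Y'} {g : Y' →ₗ[R2] Y''} (h : IsShortExact f g) :
    IsShortExact (tensorMap (k := k) (LinearMap.id : X →ₗ[R1] X) f)
      (tensorMap (k := k) (LinearMap.id : X →ₗ[R1] X) g) where
  injective := Module.Flat.lTensor_preserves_injective_linearMap (f.restrictScalars k) h.injective
  exact := lTensor_exact (f := f.restrictScalars k) (g := g.restrictScalars k) X h.exact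
    h.surjective
  surjective := LinearMap.lTensor_surjective (g := g.restrictScalars k) X h.surjective

theorem exists_isShortExact_ker (R X : Type) [CommRing R] [AddCommGroup X] [Module R X]
    [Module.Finite R X] :
    ∃ (n : ℕ) (q : (Fin n → R) →ₗ[R] X), IsShortExact q.ker.subtype q :=
  let ⟨n, q, hq⟩ := Module.Finite.exists_fin' R X
  ⟨n, q, q.ker.subtype_injective, LinearMap.exact_subtype_ker_map q, hq⟩

end Exact

namespace KunnethCompatible

variable {D1 : VanishingTheory R1} {D2 : VanishingTheory R2} {D : VanishingTheory (R1 ⊗[k] R2)}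
  {p1 : ∀ (X : Type) [AddCommGroup X] [Module R1 X], Prop}
  {p2 : ∀ (Y : Type) [AddCommGroup Y] [Module R2 Y], Prop}

theorem vanish_free_right (H : KunnethCompatible k D1 D2 D p1 p2)
    [IsNoetherianRing R1] (n m : ℕ) (X : Type) [AddCommGroup X] [Module k X] [Module R1 X]
    [IsScalarTower k R1 X] [Module.Finite R1 X] (hX : D1.vanish n X) :
    D.vanish n (X ⊗[k] (Fin m → R2)) := by
  induction n generalizing X with
  | zero =>
    obtain ⟨l, q, h⟩ := exists_isShortExact_ker R1 X
    exact D.vanish_zero (h.tensor_right _) (H.good_left _ _ (D1.good_of_vanish_zero h hX))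
      (D.vanish_of_projective _ _)
  | succ n ih =>
    obtain ⟨l, q, h⟩ := exists_isShortExact_ker R1 X
    exact D.vanish_succ (h.tensor_right _)
      (ih _ (D1.vanish_of_succ h hX (D1.vanish_of_projective _ _)))
      (D.vanish_of_projective _ _)

theorem vanish_free_left (H : KunnethCompatible k D1 D2 D p1 p2)
    [IsNoetherianRing R2] (n m : ℕ) (Y : Type) [AddCommGroup Y] [Module k Y] [Module R2 Y]
    [IsScalarTower k R2 Y] [Module.Finite R2 Y] (hY : D2.vanish n Y) :
    D.vanish n ((Fin m → R1) ⊗[k] Y) := by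
  induction n generalizing Y with
  | zero =>
    obtain ⟨l, q, h⟩ := exists_isShortExact_ker R2 Y
    exact D.vanish_zero (h.tensor_left _) (H.good_right _ _ (D2.good_of_vanish_zero h hY))
      (D.vanish_of_projective _ _)
  | succ n ih =>
    obtain ⟨l, q, h⟩ := exists_isShortExact_ker R2 Y
    exact D.vanish_succ (h.tensor_left _)
      (ih _ (D2.vanish_of_succ h hY (D2.vanish_of_projective _ _)))
      (D.vanish_of_projective _ _)

theorem vanish_tensorProduct (H : KunnethCompatible k D1 D2 D p1 p2)
    [IsNoetherianRing R1] [IsNoetherianRing R2]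
    (n : ℕ) (X Y : Type) [AddCommGroup X] [Module k X] [Module R1 X]
    [IsScalarTower k R1 X] [Module.Finite R1 X]
    [AddCommGroup Y] [Module k Y] [Module R2 Y]
    [IsScalarTower k R2 Y] [Module.Finite R2 Y]
    (hX : ∀ i ≤ n, D1.vanish i X) (hY : ∀ i ≤ n, D2.vanish i Y) :
    D.vanish n (X ⊗[k] Y) := by
  induction n generalizing X with
  | zero =>
    obtain ⟨l, q, h⟩ := exists_isShortExact_ker R1 X
    exact D.vanish_zero (h.tensor_right _)
      (H.good_left _ _ (D1.good_of_vanish_zero h (hX 0 le_rfl)))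
      (H.vanish_free_left _ _ _ (hY 0 le_rfl))
  | succ n ih =>
    obtain ⟨l, q, h⟩ := exists_isShortExact_ker R1 X
    exact D.vanish_succ (h.tensor_right _)
      (ih _ (fun i hi => D1.vanish_of_succ h (hX _ (by omega)) (D1.vanish_of_projective _ _))
        fun i hi => hY i (by omega))
      (H.vanish_free_left _ _ _ (hY _ le_rfl))

theorem vanish_right_of_tensorProduct (H : KunnethCompatible k D1 D2 D p1 p2)
    [IsNoetherianRing R1] [IsNoetherianRing R2]
    (n : ℕ) (X Y : Type) [AddCommGroup X] [Module k X] [Module R1 X]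
    [IsScalarTower k R1 X] [Module.Finite R1 X]
    [AddCommGroup Y] [Module k Y] [Module R2 Y]
    [IsScalarTower k R2 Y] [Module.Finite R2 Y]
    (p : p1 X) (hX : ∀ i < n, D1.vanish i X) (h : D.vanish n (X ⊗[k] Y)) : D2.vanish n Y := by
  induction n generalizing Y with
  | zero =>
    obtain ⟨l, q, hq⟩ := exists_isShortExact_ker R2 Y
    exact D2.vanish_zero hq
      (H.of_good_right _ _ p (D.good_of_vanish_zero (hq.tensor_left _) h))
      (D2.vanish_of_projective _ _)
  | succ n ih =>
    obtain ⟨l, q, hq⟩ := exists_isShortExact_ker R2 Y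
    exact D2.vanish_succ hq
      (ih _ (fun i hi => hX i (by omega))
        (D.vanish_of_succ (hq.tensor_left _) h (H.vanish_free_right _ _ _ (hX n (by omega)))))
      (D2.vanish_of_projective _ _)

theorem vanish_left_of_tensorProduct (H : KunnethCompatible k D1 D2 D p1 p2)
    [IsNoetherianRing R1] [IsNoetherianRing R2]
    (n : ℕ) (X Y : Type) [AddCommGroup X] [Module k X] [Module R1 X]
    [IsScalarTower k R1 X] [Module.Finite R1 X]
    [AddCommGroup Y] [Module k Y] [Module R2 Y]
    [IsScalarTower k R2 Y] [Module.Finite R2 Y]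
    (p : p2 Y) (hY : ∀ i < n, D2.vanish i Y) (h : D.vanish n (X ⊗[k] Y)) : D1.vanish n X := by
  induction n generalizing X with
  | zero =>
    obtain ⟨l, q, hq⟩ := exists_isShortExact_ker R1 X
    exact D1.vanish_zero hq
      (H.of_good_left _ _ p (D.good_of_vanish_zero (hq.tensor_right _) h))
      (D1.vanish_of_projective _ _)
  | succ n ih =>
    obtain ⟨l, q, hq⟩ := exists_isShortExact_ker R1 X
    exact D1.vanish_succ hq
      (ih _ (fun i hi => hY i (by omega))
        (D.vanish_of_succ (hq.tensor_right _) h (H.vanish_free_left _ _ _ (hY n (by omega)))))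
      (D1.vanish_of_projective _ _)

theorem forall_vanish_tensorProduct_iff (H : KunnethCompatible k D1 D2 D p1 p2)
    [IsNoetherianRing R1] [IsNoetherianRing R2]
    (X Y : Type) [AddCommGroup X] [Module k X] [Module R1 X]
    [IsScalarTower k R1 X] [Module.Finite R1 X]
    [AddCommGroup Y] [Module k Y] [Module R2 Y]
    [IsScalarTower k R2 Y] [Module.Finite R2 Y]
    (hp1 : p1 X) (hp2 : p2 Y) :
    (∀ n, D.vanish n (X ⊗[k] Y)) ↔ (∀ n, D1.vanish n X) ∧ ∀ n, D2.vanish n Y := by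
  refine ⟨fun h => forall_and.1 fun n => ?_, fun h n =>
    H.vanish_tensorProduct n X Y (fun i _ => h.1 i) fun i _ => h.2 i⟩
  induction n using Nat.strong_induction_on with
  | _ n ih =>
    exact ⟨H.vanish_left_of_tensorProduct n X Y hp2 (fun i hi => (ih i hi).2) (h n),
      H.vanish_right_of_tensorProduct n X Y hp1 (fun i hi => (ih i hi).1) (h n)⟩

end KunnethCompatible

end Kunneth

section LeftExact

variable {k : Type} [CommRing k] {A B C A' B' C' : Type} [AddCommGroup A] [AddCommGroup B]
  [AddCommGroup C] [AddCommGroup A'] [AddCommGroup B'] [AddCommGroup C']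
  [Module k A] [Module k B] [Module k C] [Module k A'] [Module k B'] [Module k C']
  {i : A →ₗ[k] B} {p : B →ₗ[k] C} {i' : A' →ₗ[k] B'} {p' : B' →ₗ[k] C'}
  {α : A → A'} {β : B → B'} {γ : C →ₗ[k] C'}

theorem bijective_of_leftExact (hi : Function.Injective i) (hp : Function.Exact i p)
    (hi' : Function.Injective i') (hp' : Function.Exact i' p')
    (h₁ : ∀ a, i' (α a) = β (i a)) (h₂ : ∀ b, p' (β b) = γ (p b))
    (hβ : Function.Bijective β) (hγ : Function.Injective γ) : Function.Bijective α := by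
  refine ⟨fun a b h => hi (hβ.1 ?_), fun a => ?_⟩
  · rw [← h₁, h, h₁]
  · obtain ⟨b, hb⟩ := hβ.2 (i' a)
    have : p b = 0 := (map_eq_zero_iff γ hγ).1 (by rw [← h₂, hb, hp'.apply_apply_eq_zero])
    obtain ⟨a', rfl⟩ := (hp b).1 this
    exact ⟨a', hi' (by rw [h₁, hb])⟩

variable (k) {R X Y Z : Type} [CommRing R] [Algebra k R] [AddCommGroup X] [Module R X]
  [AddCommGroup Y] [Module R Y] [AddCommGroup Z] [Module R Z]
  {f : X →ₗ[R] Y} {g : Y →ₗ[R] Z} (N : Type) [AddCommGroup N] [Module R N] [Module k N]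
  [IsScalarTower k R N]

theorem IsShortExact.lcomp_injective (h : IsShortExact f g) :
    Function.Injective (LinearMap.lcomp k N g) := fun a b e =>
  LinearMap.ext fun z => by
    obtain ⟨y, rfl⟩ := h.surjective z
    exact LinearMap.congr_fun e y

theorem IsShortExact.lcomp_exact (h : IsShortExact f g) :
    Function.Exact (LinearMap.lcomp k N g) (LinearMap.lcomp k N f) := by
  refine fun a => ⟨fun e => ?_, ?_⟩
  · have hk : g.ker ≤ a.ker := fun y hy => by
      obtain ⟨x, rfl⟩ := (h.exact y).1 hy
      exact LinearMap.congr_fun e x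
    refine ⟨g.ker.liftQ a hk ∘ₗ (g.quotKerEquivOfSurjective h.surjective).symm, ?_⟩
    ext y
    have : (g.quotKerEquivOfSurjective h.surjective).symm (g y) = Submodule.Quotient.mk y := by
      rw [LinearEquiv.symm_apply_eq]; rfl
    simp [this]
  · rintro ⟨b, rfl⟩
    ext x
    simp [h.exact.apply_apply_eq_zero]

end LeftExact

section HomTensor

variable (k : Type) [Field k] (R1 R2 : Type) [CommRing R1] [CommRing R2]
  [Algebra k R1] [Algebra k R2]
  (X Y N1 N2 : Type)
  [AddCommGroup X] [Module k X] [Module R1 X] [IsScalarTower k R1 X]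
  [AddCommGroup Y] [Module k Y] [Module R2 Y] [IsScalarTower k R2 Y]
  [AddCommGroup N1] [Module k N1] [Module R1 N1] [IsScalarTower k R1 N1]
  [AddCommGroup N2] [Module k N2] [Module R2 N2] [IsScalarTower k R2 N2]

/-- The natural map `Hom(X, N1) ⊗ Hom(Y, N2) → Hom(X ⊗ Y, N1 ⊗ N2)`. -/
noncomputable def homTensor :
    (X →ₗ[R1] N1) ⊗[k] (Y →ₗ[R2] N2) →ₗ[R1 ⊗[k] R2] (X ⊗[k] Y →ₗ[R1 ⊗[k] R2] N1 ⊗[k] N2) :=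
  tensorLift (TensorProduct.lift (LinearMap.mk₂ k (fun f g => tensorMap f g)
      (fun f f' g => tensorProduct_hom_ext fun x y => by simp [add_tmul])
      (fun c f g => tensorProduct_hom_ext fun x y => by simp [smul_tmul'])
      (fun f g g' => tensorProduct_hom_ext fun x y => by simp [tmul_add])
      (fun c f g => tensorProduct_hom_ext fun x y => by simp)))
    fun a b f g => tensorProduct_hom_ext fun x y => by simp [tensorModule_smul_tmul]

variable {R1 R2 X Y N1 N2}

@[simp]
theorem homTensor_tmul (f : X →ₗ[R1] N1) (g : Y →ₗ[R2] N2) :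
    homTensor k R1 R2 X Y N1 N2 (f ⊗ₜ g) = tensorMap f g := rfl

variable {X' Y' : Type}
  [AddCommGroup X'] [Module k X'] [Module R1 X'] [IsScalarTower k R1 X']
  [AddCommGroup Y'] [Module k Y'] [Module R2 Y'] [IsScalarTower k R2 Y']

theorem homTensor_naturality_left (f : X →ₗ[R1] X') (t : (X' →ₗ[R1] N1) ⊗[k] (Y →ₗ[R2] N2)) :
    LinearMap.lcomp k (N1 ⊗[k] N2) (tensorMap f LinearMap.id) (homTensor k R1 R2 X' Y N1 N2 t) =
      homTensor k R1 R2 X Y N1 N2 ((LinearMap.lcomp k N1 f).rTensor (Y →ₗ[R2] N2) t) := by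
  induction t with
  | zero => simp
  | add a b ha hb => simp only [map_add, ha, hb]
  | tmul a b => exact tensorProduct_hom_ext fun x y => rfl

theorem homTensor_naturality_right (g : Y →ₗ[R2] Y') (t : (X →ₗ[R1] N1) ⊗[k] (Y' →ₗ[R2] N2)) :
    LinearMap.lcomp k (N1 ⊗[k] N2) (tensorMap LinearMap.id g) (homTensor k R1 R2 X Y' N1 N2 t) =
      homTensor k R1 R2 X Y N1 N2 ((LinearMap.lcomp k N2 g).lTensor (X →ₗ[R1] N1) t) := by
  induction t with
  | zero => simp
  | add a b ha hb => simp only [map_add, ha, hb]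
  | tmul a b => exact tensorProduct_hom_ext fun x y => rfl

theorem homTensor_injective_of_surjective_left {q : X →ₗ[R1] X'} (hq : Function.Surjective q)
    (hX : Function.Injective (homTensor k R1 R2 X Y N1 N2)) :
    Function.Injective (homTensor k R1 R2 X' Y N1 N2) := by
  have hc : Function.Injective ((LinearMap.lcomp k N1 q).rTensor (Y →ₗ[R2] N2)) :=
    Module.Flat.rTensor_preserves_injective_linearMap _ fun a b e => (LinearMap.cancel_right hq).1 e
  refine fun s t e => hc (hX ?_)
  rw [← homTensor_naturality_left, ← homTensor_naturality_left, e]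

theorem homTensor_injective_of_surjective_right {q : Y →ₗ[R2] Y'} (hq : Function.Surjective q)
    (hY : Function.Injective (homTensor k R1 R2 X Y N1 N2)) :
    Function.Injective (homTensor k R1 R2 X Y' N1 N2) := by
  have hc : Function.Injective ((LinearMap.lcomp k N2 q).lTensor (X →ₗ[R1] N1)) :=
    Module.Flat.lTensor_preserves_injective_linearMap _ fun a b e => (LinearMap.cancel_right hq).1 e
  refine fun s t e => hc (hY ?_)
  rw [← homTensor_naturality_right, ← homTensor_naturality_right, e]

theorem IsShortExact.homTensor_bijective_left {X'' : Type} [AddCommGroup X'']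
    [Module k X''] [Module R1 X''] [IsScalarTower k R1 X''] {i : X →ₗ[R1] X'} {q : X' →ₗ[R1] X''}
    (h : IsShortExact i q) (hX' : Function.Bijective (homTensor k R1 R2 X' Y N1 N2))
    (hX : Function.Injective (homTensor k R1 R2 X Y N1 N2)) :
    Function.Bijective (homTensor k R1 R2 X'' Y N1 N2) :=
  bijective_of_leftExact (γ := (homTensor k R1 R2 X Y N1 N2).restrictScalars k)
    (Module.Flat.rTensor_preserves_injective_linearMap _ (h.lcomp_injective k N1))
    (Module.Flat.rTensor_exact _ (h.lcomp_exact k N1))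
    ((h.tensor_right (k := k) Y).lcomp_injective k _) ((h.tensor_right (k := k) Y).lcomp_exact k _)
    (homTensor_naturality_left k q) (homTensor_naturality_left k i) hX' hX

theorem IsShortExact.homTensor_bijective_right {Y'' : Type} [AddCommGroup Y'']
    [Module k Y''] [Module R2 Y''] [IsScalarTower k R2 Y''] {i : Y →ₗ[R2] Y'} {q : Y' →ₗ[R2] Y''}
    (h : IsShortExact i q) (hY' : Function.Bijective (homTensor k R1 R2 X Y' N1 N2))
    (hY : Function.Injective (homTensor k R1 R2 X Y N1 N2)) :
    Function.Bijective (homTensor k R1 R2 X Y'' N1 N2) :=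
  bijective_of_leftExact (γ := (homTensor k R1 R2 X Y N1 N2).restrictScalars k)
    (Module.Flat.lTensor_preserves_injective_linearMap _ (h.lcomp_injective k N2))
    (Module.Flat.lTensor_exact _ (h.lcomp_exact k N2))
    ((h.tensor_left (k := k) X).lcomp_injective k _) ((h.tensor_left (k := k) X).lcomp_exact k _)
    (homTensor_naturality_right k q) (homTensor_naturality_right k i) hY' hY

theorem homTensor_bijective_pi_pi (m n : ℕ) :
    Function.Bijective (homTensor k R1 R2 (Fin m → R1) (Fin n → R2) N1 N2) := by
  let c (i : Fin m) (j : Fin n) : N1 ⊗[k] N2 →ₗ[k]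
      ((Fin m → R1) →ₗ[R1] N1) ⊗[k] ((Fin n → R2) →ₗ[R2] N2) :=
    TensorProduct.map
      { toFun x := (LinearMap.proj i).smulRight x
        map_add' x y := by ext; simp
        map_smul' a x := by ext; simp [smul_comm a] }
      { toFun y := (LinearMap.proj j).smulRight y
        map_add' x y := by ext; simp
        map_smul' a x := by ext; simp [smul_comm a] }
  let e (h : (Fin m → R1) ⊗[k] (Fin n → R2) →ₗ[R1 ⊗[k] R2] N1 ⊗[k] N2) :
      ((Fin m → R1) →ₗ[R1] N1) ⊗[k] ((Fin n → R2) →ₗ[R2] N2) :=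
    ∑ i, ∑ j, c i j (h (Pi.single i 1 ⊗ₜ Pi.single j 1))
  have hl {R N : Type} [CommRing R] [AddCommGroup N] [Module R N] {m : ℕ}
      (f : (Fin m → R) →ₗ[R] N) :
      f = ∑ i, (LinearMap.proj i : (Fin m → R) →ₗ[R] R).smulRight (f (Pi.single i 1)) := by
    ext i
    simp [Pi.single_apply]
  have he (t) : e (homTensor k R1 R2 _ _ N1 N2 t) = t := by
    induction t with
    | zero => simp [e]
    | add a b ha hb =>
      conv_rhs => rw [← ha, ← hb]
      simp [e, Finset.sum_add_distrib]
    | tmul f g =>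
      conv_rhs => rw [hl f, hl g]
      simp only [tmul_sum, sum_tmul]
      rw [Finset.sum_comm]
      rfl
  have hc (i j) (t : N1 ⊗[k] N2) (x y) : homTensor k R1 R2 (Fin m → R1) (Fin n → R2) N1 N2 (c i j t)
      (x ⊗ₜ y) = (x i ⊗ₜ[k] y j : R1 ⊗[k] R2) • t := by
    induction t with
    | zero => simp
    | add a b ha hb => rw [map_add, map_add, LinearMap.add_apply, ha, hb, smul_add]
    | tmul a b => rfl
  refine Function.bijective_iff_has_inverse.2 ⟨e, he, fun h => tensorProduct_hom_ext fun x y => ?_⟩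
  conv_rhs => rw [pi_eq_sum_univ' x, pi_eq_sum_univ' y]
  simp only [e, map_sum, LinearMap.sum_apply, hc, tmul_sum, sum_tmul]
  rw [Finset.sum_comm]
  refine Finset.sum_congr rfl fun j _ => Finset.sum_congr rfl fun i _ => ?_
  rw [← map_smul]
  rfl

variable (X Y N1 N2) in
theorem homTensor_bijective [IsNoetherianRing R1] [IsNoetherianRing R2] [Module.Finite R1 X]
    [Module.Finite R2 Y] : Function.Bijective (homTensor k R1 R2 X Y N1 N2) := by
  have hfree (n : ℕ) (X : Type) [AddCommGroup X] [Module k X] [Module R1 X] [IsScalarTower k R1 X]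
      [Module.Finite R1 X] : Function.Bijective (homTensor k R1 R2 X (Fin n → R2) N1 N2) := by
    obtain ⟨m, q, h⟩ := exists_isShortExact_ker R1 X
    obtain ⟨l, q', h'⟩ := exists_isShortExact_ker R1 q.ker
    exact h.homTensor_bijective_left k (homTensor_bijective_pi_pi k m n)
      (homTensor_injective_of_surjective_left k h'.surjective (homTensor_bijective_pi_pi k l n).1)
  obtain ⟨m, q, h⟩ := exists_isShortExact_ker R2 Y
  obtain ⟨l, q', h'⟩ := exists_isShortExact_ker R2 q.ker
  exact h.homTensor_bijective_right k (hfree m X)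
    (homTensor_injective_of_surjective_right k h'.surjective (hfree l X).1)

end HomTensor

section ExtKunneth

variable (k : Type) [Field k] (R1 R2 : Type) [CommRing R1] [CommRing R2]
  [Algebra k R1] [Algebra k R2] [IsNoetherianRing R1] [IsNoetherianRing R2]
  (N1 N2 : Type)
  [AddCommGroup N1] [Module k N1] [Module R1 N1] [IsScalarTower k R1 N1]
  [AddCommGroup N2] [Module k N2] [Module R2 N2] [IsScalarTower k R2 N2]

theorem kunnethCompatible_extVanishing :
    KunnethCompatible k (extVanishing R1 N1) (extVanishing R2 N2)
      (extVanishing (R1 ⊗[k] R2) (N1 ⊗[k] N2)) (fun X => Nontrivial (X →ₗ[R1] N1))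
      (fun Y => Nontrivial (Y →ₗ[R2] N2)) where
  good_left {X X'} Y _ _ _ _ _ _ _ _ _ _ _ _ _ _ _ f hf h := by
    obtain ⟨t, rfl⟩ := (homTensor_bijective k X Y N1 N2).2 h
    obtain ⟨s, rfl⟩ := LinearMap.rTensor_surjective (g := LinearMap.lcomp k N1 f)
      (Y →ₗ[R2] N2) hf t
    exact ⟨_, homTensor_naturality_left k f s⟩
  good_right X {Y Y'} _ _ _ _ _ _ _ _ _ _ _ _ _ _ _ g hg h := by
    obtain ⟨t, rfl⟩ := (homTensor_bijective k X Y N1 N2).2 h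
    obtain ⟨s, rfl⟩ := LinearMap.lTensor_surjective (g := LinearMap.lcomp k N2 g)
      (X →ₗ[R1] N1) hg t
    exact ⟨_, homTensor_naturality_right k g s⟩
  of_good_left {X X'} Y _ _ _ _ _ _ _ _ _ _ _ _ _ _ _ f hY hf := by
    refine (Module.FaithfullyFlat.lTensor_surjective_iff_surjective k (Y →ₗ[R2] N2)
      (LinearMap.lcomp k N1 f)).1 ((LinearMap.lTensor_surj_iff_rTensor_surj _ _).2 fun t => ?_)
    obtain ⟨h, hh⟩ := hf (homTensor k R1 R2 X Y N1 N2 t)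
    obtain ⟨s, rfl⟩ := (homTensor_bijective k X' Y N1 N2).2 h
    exact ⟨s, (homTensor_bijective k X Y N1 N2).1 ((homTensor_naturality_left k f s).symm.trans hh)⟩
  of_good_right X {Y Y'} _ _ _ _ _ _ _ _ _ _ _ _ _ _ _ g hX hg := by
    refine (Module.FaithfullyFlat.lTensor_surjective_iff_surjective k (X →ₗ[R1] N1)
      (LinearMap.lcomp k N2 g)).1 fun t => ?_
    obtain ⟨h, hh⟩ := hg (homTensor k R1 R2 X Y N1 N2 t)
    obtain ⟨s, rfl⟩ := (homTensor_bijective k X Y' N1 N2).2 h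
    exact ⟨s, (homTensor_bijective k X Y N1 N2).1 ((homTensor_naturality_right k g s).symm.trans hh)⟩

end ExtKunneth

section TensorTensor

variable (k : Type) [Field k] (R1 R2 : Type) [CommRing R1] [CommRing R2]
  [Algebra k R1] [Algebra k R2]
  (X Y H1 H2 : Type)
  [AddCommGroup X] [Module k X] [Module R1 X] [IsScalarTower k R1 X]
  [AddCommGroup Y] [Module k Y] [Module R2 Y] [IsScalarTower k R2 Y]
  [AddCommGroup H1] [Module k H1] [Module R1 H1] [IsScalarTower k R1 H1]
  [AddCommGroup H2] [Module k H2] [Module R2 H2] [IsScalarTower k R2 H2]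

/-- The map `(X ⊗[k] Y) ⊗ (H1 ⊗[k] H2) → (X ⊗[R1] H1) ⊗[k] (Y ⊗[R2] H2)`, swapping the middle
factors. -/
noncomputable def tensorTensorHom :
    (X ⊗[k] Y) ⊗[R1 ⊗[k] R2] (H1 ⊗[k] H2) →ₗ[R1 ⊗[k] R2] (X ⊗[R1] H1) ⊗[k] (Y ⊗[R2] H2) :=
  TensorProduct.lift ((homTensor k R1 R2 H1 H2 (X ⊗[R1] H1) (Y ⊗[R2] H2)).comp
    (tensorMap (TensorProduct.mk R1 X H1) (TensorProduct.mk R2 Y H2)))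

variable {X Y H1 H2}

@[simp]
theorem tensorTensorHom_tmul (x : X) (y : Y) (a : H1) (b : H2) :
    tensorTensorHom k R1 R2 X Y H1 H2 ((x ⊗ₜ y) ⊗ₜ (a ⊗ₜ b)) = (x ⊗ₜ a) ⊗ₜ (y ⊗ₜ b) := rfl

variable (X Y H1 H2)

theorem tensorTensorHom_bijective : Function.Bijective (tensorTensorHom k R1 R2 X Y H1 H2) := by
  have hR1 (r : R1) (x : X) (y : Y) (a : H1) (b : H2) :
      ((r • x) ⊗ₜ[k] y) ⊗ₜ[R1 ⊗[k] R2] (a ⊗ₜ[k] b) = (x ⊗ₜ y) ⊗ₜ ((r • a) ⊗ₜ b) := by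
    simpa [tensorModule_smul_tmul] using
      smul_tmul (r ⊗ₜ[k] (1 : R2)) (x ⊗ₜ[k] y) (a ⊗ₜ[k] b)
  have hR2 (r : R2) (x : X) (y : Y) (a : H1) (b : H2) :
      (x ⊗ₜ[k] (r • y)) ⊗ₜ[R1 ⊗[k] R2] (a ⊗ₜ[k] b) = (x ⊗ₜ y) ⊗ₜ (a ⊗ₜ (r • b)) := by
    simpa [tensorModule_smul_tmul] using
      smul_tmul ((1 : R1) ⊗ₜ[k] r) (x ⊗ₜ[k] y) (a ⊗ₜ[k] b)
  have hext {T : Type} [AddCommGroup T] {f g : Y ⊗[R2] H2 →+ T}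
      (h : ∀ y b, f (y ⊗ₜ b) = g (y ⊗ₜ b)) : f = g := by
    ext t
    induction t with
    | zero => simp
    | add t t' h h' => rw [map_add, map_add, h, h']
    | tmul y b => exact h y b
  let φ (x : X) (a : H1) : Y ⊗[R2] H2 →+ (X ⊗[k] Y) ⊗[R1 ⊗[k] R2] (H1 ⊗[k] H2) :=
    liftAddHom (AddMonoidHom.mk' (fun y => AddMonoidHom.mk' (fun b => (x ⊗ₜ y) ⊗ₜ (a ⊗ₜ b))
      fun b b' => by simp [tmul_add]) fun y y' => by ext; simp [tmul_add, add_tmul])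
      fun r y b => hR2 r x y a b
  let ψ : X ⊗[R1] H1 →+ Y ⊗[R2] H2 →+ (X ⊗[k] Y) ⊗[R1 ⊗[k] R2] (H1 ⊗[k] H2) :=
    liftAddHom (AddMonoidHom.mk' (fun x => AddMonoidHom.mk' (fun a => φ x a)
      fun a a' => hext fun y b => by simp [φ, tmul_add, add_tmul]; rfl)
      fun x x' => by ext a : 1; exact hext fun y b => by simp [φ, add_tmul]; rfl)
      fun r x a => hext fun y b => hR1 r x y a b
  have hψ (c : k) (u : X ⊗[R1] H1) (v : Y ⊗[R2] H2) : ψ (c • u) v = ψ u (c • v) := by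
    induction u with
    | zero => simp
    | add u u' hu hu' => simp only [smul_add, map_add, AddMonoidHom.add_apply, hu, hu']
    | tmul x a =>
      induction v with
      | zero => simp
      | add v v' hv hv' => simp only [smul_add, map_add, hv, hv']
      | tmul y b =>
        change ((c • x) ⊗ₜ[k] y) ⊗ₜ[R1 ⊗[k] R2] (a ⊗ₜ[k] b) = (x ⊗ₜ (c • y)) ⊗ₜ (a ⊗ₜ b)
        rw [smul_tmul]
  let χ : (X ⊗[R1] H1) ⊗[k] (Y ⊗[R2] H2) →+ (X ⊗[k] Y) ⊗[R1 ⊗[k] R2] (H1 ⊗[k] H2) :=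
    liftAddHom ψ fun c u v => hψ c u v
  refine Function.bijective_iff_has_inverse.2 ⟨χ, fun t => ?_, fun t => ?_⟩
  · induction t with
    | zero => simp
    | add t t' h h' => rw [map_add, map_add, h, h']
    | tmul u v =>
      induction u with
      | zero => simp
      | add u u' hu hu' => simp only [add_tmul, map_add, hu, hu']
      | tmul x y =>
        induction v with
        | zero => simp
        | add v v' hv hv' => simp only [tmul_add, map_add, hv, hv']
        | tmul a b => rfl
  · induction t with
    | zero => simp
    | add t t' h h' => rw [map_add, map_add, h, h']
    | tmul u v =>
      induction u with
      | zero => simp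
      | add u u' hu hu' => simp only [add_tmul, map_add, hu, hu']
      | tmul x a =>
        induction v with
        | zero => simp
        | add v v' hv hv' => simp only [tmul_add, map_add, hv, hv']
        | tmul y b => rfl

variable {X Y H1 H2}
variable {X' Y' : Type}
  [AddCommGroup X'] [Module k X'] [Module R1 X'] [IsScalarTower k R1 X']
  [AddCommGroup Y'] [Module k Y'] [Module R2 Y'] [IsScalarTower k R2 Y']

theorem tensorTensorHom_naturality (f : X →ₗ[R1] X') (g : Y →ₗ[R2] Y')
    (t : (X ⊗[k] Y) ⊗[R1 ⊗[k] R2] (H1 ⊗[k] H2)) :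
    tensorTensorHom k R1 R2 X' Y' H1 H2 ((tensorMap f g).rTensor (H1 ⊗[k] H2) t) =
      tensorMap (f.rTensor H1) (g.rTensor H2) (tensorTensorHom k R1 R2 X Y H1 H2 t) := by
  induction t with
  | zero => simp
  | add t t' h h' => simp only [map_add, h, h']
  | tmul u v =>
    induction u with
    | zero => simp
    | add u u' hu hu' => simp only [add_tmul, map_add, hu, hu']
    | tmul x y =>
      induction v with
      | zero => simp
      | add v v' hv hv' => simp only [tmul_add, map_add, hv, hv']
      | tmul a b => rfl

variable (H1 H2) in
theorem rTensor_tensorMap_injective_iff (f : X →ₗ[R1] X') (g : Y →ₗ[R2] Y') :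
    Function.Injective ((tensorMap (k := k) f g).rTensor (H1 ⊗[k] H2)) ↔
      Function.Injective (tensorMap (k := k) (f.rTensor H1) (g.rTensor H2)) := by
  rw [← (tensorTensorHom_bijective k R1 R2 X' Y' H1 H2).injective.of_comp_iff,
    ← Function.Injective.of_comp_iff' _ (tensorTensorHom_bijective k R1 R2 X Y H1 H2)]
  exact iff_of_eq (congrArg _ (funext fun t => tensorTensorHom_naturality k R1 R2 f g t))

theorem kunnethCompatible_torVanishing :
    KunnethCompatible k (torVanishing R1 H1) (torVanishing R2 H2)
      (torVanishing (R1 ⊗[k] R2) (H1 ⊗[k] H2)) (fun X => Nontrivial (X ⊗[R1] H1))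
      (fun Y => Nontrivial (Y ⊗[R2] H2)) where
  good_left {X X'} Y _ _ _ _ _ _ _ _ _ _ _ _ _ _ _ f hf := by
    refine (rTensor_tensorMap_injective_iff k R1 R2 H1 H2 f LinearMap.id).2 ?_
    rw [LinearMap.rTensor_id]
    exact Module.Flat.rTensor_preserves_injective_linearMap ((f.rTensor H1).restrictScalars k) hf
  good_right X {Y Y'} _ _ _ _ _ _ _ _ _ _ _ _ _ _ _ g hg := by
    refine (rTensor_tensorMap_injective_iff k R1 R2 H1 H2 LinearMap.id g).2 ?_
    rw [LinearMap.rTensor_id]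
    exact Module.Flat.lTensor_preserves_injective_linearMap ((g.rTensor H2).restrictScalars k) hg
  of_good_left {X X'} Y _ _ _ _ _ _ _ _ _ _ _ _ _ _ _ f hY hf := by
    replace hf := (rTensor_tensorMap_injective_iff k R1 R2 H1 H2 f LinearMap.id).1 hf
    rw [LinearMap.rTensor_id] at hf
    exact (Module.FaithfullyFlat.lTensor_injective_iff_injective k (Y ⊗[R2] H2)
      ((f.rTensor H1).restrictScalars k)).1 ((LinearMap.lTensor_inj_iff_rTensor_inj _ _).2 hf)
  of_good_right X {Y Y'} _ _ _ _ _ _ _ _ _ _ _ _ _ _ _ g hX hg := by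
    replace hg := (rTensor_tensorMap_injective_iff k R1 R2 H1 H2 LinearMap.id g).1 hg
    rw [LinearMap.rTensor_id] at hg
    exact (Module.FaithfullyFlat.lTensor_injective_iff_injective k (X ⊗[R1] H1)
      ((g.rTensor H2).restrictScalars k)).1 hg

end TensorTensor

theorem nontrivial_and_nontrivial_of_tensorProduct {R M N : Type} [CommRing R] [AddCommGroup M]
    [Module R M] [AddCommGroup N] [Module R N] [Nontrivial (M ⊗[R] N)] :
    Nontrivial M ∧ Nontrivial N := by
  constructor <;> by_contra h <;> rw [not_nontrivial_iff_subsingleton] at h <;>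
    exact not_subsingleton (M ⊗[R] N) inferInstance

section TensorMapBijective

variable {k V W V' W' : Type} [Field k] [AddCommGroup V] [Module k V] [AddCommGroup W] [Module k W]
  [AddCommGroup V'] [Module k V'] [AddCommGroup W'] [Module k W']

theorem bijective_of_bijective_map [Nontrivial W] [Nontrivial W'] {f : V →ₗ[k] W}
    {g : V' →ₗ[k] W'} (h : Function.Bijective (TensorProduct.map f g)) :
    Function.Bijective f ∧ Function.Bijective g := by
  have : Nontrivial (V ⊗[k] V') := (Equiv.ofBijective _ h).nontrivial
  obtain ⟨_, _⟩ := nontrivial_and_nontrivial_of_tensorProduct (R := k) (M := V) (N := V')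
  have h₁ : Function.Bijective (f.rTensor W' ∘ g.lTensor V) := by
    rwa [← LinearMap.coe_comp, LinearMap.rTensor_comp_lTensor]
  have h₂ : Function.Bijective (g.lTensor W ∘ f.rTensor V') := by
    rwa [← LinearMap.coe_comp, LinearMap.lTensor_comp_rTensor]
  exact ⟨⟨(Module.FaithfullyFlat.lTensor_injective_iff_injective k V' f).1
      ((LinearMap.lTensor_inj_iff_rTensor_inj _ _).2 h₂.1.of_comp),
    (Module.FaithfullyFlat.lTensor_surjective_iff_surjective k W' f).1
      ((LinearMap.lTensor_surj_iff_rTensor_surj _ _).2 h₁.2.of_comp)⟩,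
    (Module.FaithfullyFlat.lTensor_injective_iff_injective k V g).1 h₁.1.of_comp,
    (Module.FaithfullyFlat.lTensor_surjective_iff_surjective k W g).1 h₂.2.of_comp⟩

end TensorMapBijective

/-- The evaluation map `C ⊗ Hom(C, M) → M`. -/
noncomputable def evaluationMap (R C M : Type) [CommRing R] [AddCommGroup C] [Module R C]
    [AddCommGroup M] [Module R M] : C ⊗[R] (C →ₗ[R] M) →ₗ[R] M :=
  TensorProduct.lift (LinearMap.id : (C →ₗ[R] M) →ₗ[R] (C →ₗ[R] M)).flip

theorem memBassClass_iff (R C M : Type) [CommRing R] [AddCommGroup C] [Module R C]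
    [AddCommGroup M] [Module R M] :
    MemBassClass R C M ↔ Function.Bijective (evaluationMap R C M) ∧
      (∀ n, (extVanishing R M).vanish n C) ∧ ∀ n, (torVanishing R (C →ₗ[R] M)).vanish n C := by
  have hpos {p : ℕ → Prop} : (∀ i, 0 < i → p i) ↔ ∀ n, p (n + 1) :=
    ⟨fun h n => h _ n.succ_pos, fun h i hi => by
      obtain ⟨n, rfl⟩ := Nat.exists_eq_add_one_of_ne_zero hi.ne'
      exact h n⟩
  exact and_congr .rfl (and_congr hpos hpos)

section Evaluation

variable (k : Type) [Field k] (R1 R2 : Type) [CommRing R1] [CommRing R2]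
  [Algebra k R1] [Algebra k R2] (C1 C2 : Type)
  [AddCommGroup C1] [Module k C1] [Module R1 C1] [IsScalarTower k R1 C1]
  [AddCommGroup C2] [Module k C2] [Module R2 C2] [IsScalarTower k R2 C2] (N1 N2 : Type)
  [AddCommGroup N1] [Module k N1] [Module R1 N1] [IsScalarTower k R1 N1]
  [AddCommGroup N2] [Module k N2] [Module R2 N2] [IsScalarTower k R2 N2]

theorem evaluationMap_lTensor_homTensor
    (t : (C1 ⊗[k] C2) ⊗[R1 ⊗[k] R2] ((C1 →ₗ[R1] N1) ⊗[k] (C2 →ₗ[R2] N2))) :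
    evaluationMap (R1 ⊗[k] R2) (C1 ⊗[k] C2) (N1 ⊗[k] N2)
        ((homTensor k R1 R2 C1 C2 N1 N2).lTensor _ t) =
      tensorMap (evaluationMap R1 C1 N1) (evaluationMap R2 C2 N2)
        (tensorTensorHom k R1 R2 C1 C2 _ _ t) := by
  induction t with
  | zero => simp
  | add t t' h h' => simp only [map_add, h, h']
  | tmul u v =>
    induction u with
    | zero => simp
    | add u u' hu hu' => simp only [add_tmul, map_add, hu, hu']
    | tmul x y =>
      induction v with
      | zero => simp
      | add v v' hv hv' => simp only [tmul_add, map_add, hv, hv']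
      | tmul a b => rfl

variable [IsNoetherianRing R1] [IsNoetherianRing R2] [Module.Finite R1 C1] [Module.Finite R2 C2]

/-- For finite modules over noetherian algebras over a field, `Hom` commutes with tensor
products. -/
noncomputable def homTensorEquiv :
    (C1 →ₗ[R1] N1) ⊗[k] (C2 →ₗ[R2] N2) ≃ₗ[R1 ⊗[k] R2]
      (C1 ⊗[k] C2 →ₗ[R1 ⊗[k] R2] N1 ⊗[k] N2) :=
  LinearEquiv.ofBijective (homTensor k R1 R2 C1 C2 N1 N2) (homTensor_bijective k C1 C2 N1 N2)

theorem evaluationMap_tensorProduct_bijective_iff :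
    Function.Bijective (evaluationMap (R1 ⊗[k] R2) (C1 ⊗[k] C2) (N1 ⊗[k] N2)) ↔
      Function.Bijective (TensorProduct.map ((evaluationMap R1 C1 N1).restrictScalars k)
        ((evaluationMap R2 C2 N2).restrictScalars k)) := by
  have h : Function.Bijective ((homTensor k R1 R2 C1 C2 N1 N2).lTensor (C1 ⊗[k] C2)) :=
    (LinearEquiv.lTensor (C1 ⊗[k] C2) (homTensorEquiv k R1 R2 C1 C2 N1 N2)).bijective
  rw [← Function.Bijective.of_comp_iff _ h,
    ← Function.Bijective.of_comp_iff _ (tensorTensorHom_bijective k R1 R2 C1 C2 _ _)]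
  exact iff_of_eq (congrArg _ (funext fun t => evaluationMap_lTensor_homTensor k R1 R2 C1 C2 N1 N2 t))

theorem torVanishing_homTensor_iff :
    (∀ n, (torVanishing (R1 ⊗[k] R2) (C1 ⊗[k] C2 →ₗ[R1 ⊗[k] R2] N1 ⊗[k] N2)).vanish n
      (C1 ⊗[k] C2)) ↔ ∀ n, (torVanishing (R1 ⊗[k] R2)
        ((C1 →ₗ[R1] N1) ⊗[k] (C2 →ₗ[R2] N2))).vanish n (C1 ⊗[k] C2) :=
  forall_congr' fun n =>
    (subsingleton_torGroup_congr _ (homTensorEquiv k R1 R2 C1 C2 N1 N2) (n + 1)).symm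

end Evaluation

open TensorProduct in
/-- Let `k` be a field, `R1`, `R2` nonzero commutative noetherian `k`-algebras,
`C1`, `C2` semidualizing modules over `R1`, `R2` respectively, and `N1`, `N2` modules
over `R1`, `R2` respectively.  If `N1 ∈ B_{C1}(R1)` and `N2 ∈ B_{C2}(R2)` then
`N1 ⊗[k] N2 ∈ B_{C1 ⊗[k] C2}(R1 ⊗[k] R2)`; conversely, if `N1 ≠ 0 ≠ N2` and
`N1 ⊗[k] N2 ∈ B_{C1 ⊗[k] C2}(R1 ⊗[k] R2)`, then `N1 ∈ B_{C1}(R1)` and `N2 ∈ B_{C2}(R2)`. -/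
theorem memBassClass_tensorProduct
    (k : Type) [Field k] (R1 R2 : Type) [CommRing R1] [CommRing R2]
    [Algebra k R1] [Algebra k R2] [Nontrivial R1] [Nontrivial R2]
    [IsNoetherianRing R1] [IsNoetherianRing R2]
    (C1 C2 : Type) [AddCommGroup C1] [Module k C1] [Module R1 C1] [IsScalarTower k R1 C1]
    [AddCommGroup C2] [Module k C2] [Module R2 C2] [IsScalarTower k R2 C2]
    (hC1 : IsSemidualizing R1 C1) (hC2 : IsSemidualizing R2 C2)
    (N1 N2 : Type) [AddCommGroup N1] [Module k N1] [Module R1 N1] [IsScalarTower k R1 N1]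
    [AddCommGroup N2] [Module k N2] [Module R2 N2] [IsScalarTower k R2 N2] :
    (MemBassClass R1 C1 N1 → MemBassClass R2 C2 N2 →
      MemBassClass (R1 ⊗[k] R2) (C1 ⊗[k] C2) (N1 ⊗[k] N2)) ∧
    (Nontrivial N1 → Nontrivial N2 →
      MemBassClass (R1 ⊗[k] R2) (C1 ⊗[k] C2) (N1 ⊗[k] N2) →
      MemBassClass R1 C1 N1 ∧ MemBassClass R2 C2 N2) := by
  have := hC1.1
  have := hC2.1
  have hE := kunnethCompatible_extVanishing k R1 R2 N1 N2
  have hT := kunnethCompatible_torVanishing k R1 R2 (H1 := C1 →ₗ[R1] N1) (H2 := C2 →ₗ[R2] N2)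
  rw [memBassClass_iff, memBassClass_iff, memBassClass_iff,
    evaluationMap_tensorProduct_bijective_iff, torVanishing_homTensor_iff]
  refine ⟨fun ⟨h₁, e₁, t₁⟩ ⟨h₂, e₂, t₂⟩ => ⟨?_, fun n =>
    hE.vanish_tensorProduct n _ _ (fun i _ => e₁ i) fun i _ => e₂ i, fun n =>
    hT.vanish_tensorProduct n _ _ (fun i _ => t₁ i) fun i _ => t₂ i⟩, fun _ _ ⟨h, e, t⟩ => ?_⟩
  · exact (TensorProduct.congr
      (LinearEquiv.ofBijective ((evaluationMap R1 C1 N1).restrictScalars k) h₁)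
      (LinearEquiv.ofBijective ((evaluationMap R2 C2 N2).restrictScalars k) h₂)).bijective
  · obtain ⟨h₁, h₂⟩ := bijective_of_bijective_map h
    have n₁ : Nontrivial (C1 ⊗[R1] (C1 →ₗ[R1] N1)) := (Equiv.ofBijective _ h₁).nontrivial
    have n₂ : Nontrivial (C2 ⊗[R2] (C2 →ₗ[R2] N2)) := (Equiv.ofBijective _ h₂).nontrivial
    have hom₁ : Nontrivial (C1 →ₗ[R1] N1) :=
      (nontrivial_and_nontrivial_of_tensorProduct (R := R1) (M := C1)).2
    have hom₂ : Nontrivial (C2 →ₗ[R2] N2) :=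
      (nontrivial_and_nontrivial_of_tensorProduct (R := R2) (M := C2)).2
    obtain ⟨e₁, e₂⟩ := (hE.forall_vanish_tensorProduct_iff C1 C2 hom₁ hom₂).1 e
    obtain ⟨t₁, t₂⟩ := (hT.forall_vanish_tensorProduct_iff C1 C2 n₁ n₂).1 t
    exact ⟨⟨h₁, e₁, t₁⟩, h₂, e₂, t₂⟩
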